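/- Inside M_e(K) one has the equalities of sets b*·ι(𝔪_1) = ι(𝔪_e)·b*, and b*·ι(𝔪_i) = ι(𝔪_{i−1})·b* for every 2 ≤ i ≤ e. (Consequently, B* ⊗_B S_1 ≅ S_e and B* ⊗_B S_i ≅ S_{i−1} for i ≥ 2, where S_i := B/𝔪_i.) -/

import Mathlib

/-!
STATEMENT 2: The trace-dual lattice of `B` in `M_e(K)` equals `B* = b*·ι(B) = ι(B)·b*`,
and consists exactly of the matrices with entries in `R` on and below the diagonal and in
`u⁻¹R` above the diagonal.  Here `R = ℂ[[u,v]]`, `K = Frac R`, and `B ⊆ M_e(R)` is the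
subalgebra of matrices whose entries below the diagonal lie in `uR`.
-/

noncomputable section

/-- `R = ℂ[[u,v]]`, the ring of formal power series in two variables over `ℂ`. -/
abbrev R : Type := MvPowerSeries (Fin 2) ℂ

instance : IsDomain R := NoZeroDivisors.to_isDomain _

/-- `K`, the field of fractions of `R`. -/
abbrev K : Type := FractionRing R

/-- The variable `u ∈ R`. -/
abbrev u : R := MvPowerSeries.X 0

/-- The variable `v ∈ R`. -/
abbrev v : R := MvPowerSeries.X 1

/-- The set `B ⊆ M_e(R)` of matrices whose entries strictly below the diagonal lie in `uR`. -/
def Bset (e : ℕ) : Set (Matrix (Fin e) (Fin e) R) :=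
  {g | ∀ i j : Fin e, j < i → g i j ∈ Ideal.span {u}}

/-- The matrix `b* ∈ M_e(K)`, with `u⁻¹` on the first superdiagonal, `1` in the lower left
corner, and `0` elsewhere. -/
def bstar (e : ℕ) : Matrix (Fin e) (Fin e) K :=
  Matrix.of fun i j =>
    if (i : ℕ) + 1 = (j : ℕ) then (algebraMap R K u)⁻¹
    else if (i : ℕ) = e - 1 ∧ (j : ℕ) = 0 then 1 else 0

/-- The entrywise inclusion `ι : M_e(R) → M_e(K)`. -/
def ι (e : ℕ) (g : Matrix (Fin e) (Fin e) R) : Matrix (Fin e) (Fin e) K :=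
  g.map (algebraMap R K)

/-- `𝔪_i ⊆ B`: the elements of `B` whose `(i,i)` entry lies in the maximal ideal
`𝔪 = (u,v)` of `R`. -/
def mset (e : ℕ) (i : Fin e) : Set (Matrix (Fin e) (Fin e) R) :=
  {g | g ∈ Bset e ∧ g i i ∈ Ideal.span {u, v}}

/-!
STATEMENT 5: Inside `M_e(K)` one has `b*·ι(𝔪_1) = ι(𝔪_e)·b*` and
`b*·ι(𝔪_i) = ι(𝔪_{i−1})·b*` for `2 ≤ i ≤ e`.
(With 0-based indexing, `𝔪_1` is `mset e 0` and `𝔪_e` is `mset e (e-1)`.)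
-/

/-- The nonzero entry of `u • b*` in row `i`. -/
def bstarCoeff (n : ℕ) (i : Fin (n + 1)) : R :=
  if i = Fin.last n then u else 1

lemma u_ne_zero : u ≠ 0 := fun h => by
  have := MvPowerSeries.coeff_index_single_self_X (R := ℂ) (0 : Fin 2)
  simp [h] at this

lemma bstarCoeff_last (n : ℕ) : bstarCoeff n (Fin.last n) = u := if_pos rfl

lemma bstarCoeff_of_ne_last {n : ℕ} {i : Fin (n + 1)} (hi : i ≠ Fin.last n) :
    bstarCoeff n i = 1 := if_neg hi

lemma bstarCoeff_ne_zero (n : ℕ) (i : Fin (n + 1)) : bstarCoeff n i ≠ 0 := by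
  unfold bstarCoeff
  split_ifs
  exacts [u_ne_zero, one_ne_zero]

lemma finRotate_lt_finRotate {n : ℕ} {i j : Fin (n + 1)} (hi : i ≠ Fin.last n)
    (hj : j ≠ Fin.last n) : finRotate (n + 1) j < finRotate (n + 1) i ↔ j < i := by
  rw [Fin.lt_def, Fin.lt_def, coe_finRotate_of_ne_last hi, coe_finRotate_of_ne_last hj]
  omega

lemma finRotate_pos {n : ℕ} {i : Fin (n + 1)} (hi : i ≠ Fin.last n) :
    0 < finRotate (n + 1) i := by
  rw [Fin.lt_def, coe_finRotate_of_ne_last hi]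
  exact Nat.succ_pos _

lemma bstar_apply_finRotate (n : ℕ) (i j : Fin (n + 1)) :
    bstar (n + 1) i (finRotate (n + 1) j) =
      if i = j then (algebraMap R K u)⁻¹ * algebraMap R K (bstarCoeff n i) else 0 := by
  have hu : algebraMap R K u ≠ 0 := by simpa using u_ne_zero
  by_cases hjl : j = Fin.last n
  · subst hjl
    by_cases hil : i = Fin.last n
    · subst hil
      simp [bstar, bstarCoeff_last, hu]
    · have : (i : ℕ) ≠ n := fun h => hil (Fin.ext h)
      simp [bstar, hil, this]
  · simp only [bstar, Matrix.of_apply, coe_finRotate_of_ne_last hjl, Fin.ext_iff]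
    by_cases hij : i = j
    · subst hij
      simp [bstarCoeff_of_ne_last hjl]
    · have : (i : ℕ) ≠ j := fun h => hij (Fin.ext h)
      simp [this]

/-- Multiplying by `b*` on the left or right shifts indices cyclically and rescales. -/
lemma bstar_mul_eq_mul_bstar_iff (n : ℕ) (g h : Matrix (Fin (n + 1)) (Fin (n + 1)) R) :
    bstar (n + 1) * ι (n + 1) g = ι (n + 1) h * bstar (n + 1) ↔
      ∀ i j, bstarCoeff n i * g (finRotate (n + 1) i) (finRotate (n + 1) j) =
        h i j * bstarCoeff n j := by
  have hu : (algebraMap R K u)⁻¹ ≠ 0 := inv_ne_zero (by simpa using u_ne_zero)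
  have left (i j) : (bstar (n + 1) * ι (n + 1) g) i (finRotate (n + 1) j) =
      (algebraMap R K u)⁻¹ * algebraMap R K
        (bstarCoeff n i * g (finRotate (n + 1) i) (finRotate (n + 1) j)) := by
    rw [Matrix.mul_apply, ← Equiv.sum_comp (finRotate (n + 1))]
    simp only [bstar_apply_finRotate, ite_mul, zero_mul, Finset.sum_ite_eq, Finset.mem_univ,
      if_true, ι, Matrix.map_apply, map_mul, mul_assoc]
  have right (i j) : (ι (n + 1) h * bstar (n + 1)) i (finRotate (n + 1) j) =
      (algebraMap R K u)⁻¹ * algebraMap R K (h i j * bstarCoeff n j) := by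
    rw [Matrix.mul_apply]
    simp only [bstar_apply_finRotate, mul_ite, mul_zero, Finset.sum_ite_eq', Finset.mem_univ,
      if_true, ι, Matrix.map_apply, map_mul, mul_left_comm]
  rw [← Matrix.ext_iff]
  refine forall_congr' fun i => ?_
  rw [← (finRotate (n + 1)).forall_congr_right]
  refine forall_congr' fun j => ?_
  rw [left, right, mul_right_inj' hu, (IsFractionRing.injective R K).eq_iff]

lemma exists_mem_Bset_bstar_mul_eq {n : ℕ} {g : Matrix (Fin (n + 1)) (Fin (n + 1)) R}
    (hg : g ∈ Bset (n + 1)) :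
    ∃ h ∈ Bset (n + 1), bstar (n + 1) * ι (n + 1) g = ι (n + 1) h * bstar (n + 1) := by
  have entry (i j : Fin (n + 1)) : ∃ x : R,
      bstarCoeff n i * g (finRotate (n + 1) i) (finRotate (n + 1) j) = x * bstarCoeff n j ∧
        (j < i → u ∣ x) := by
    by_cases hi : i = Fin.last n <;> by_cases hj : j = Fin.last n
    · subst hi hj
      exact ⟨_, mul_comm _ _, fun h => absurd h (lt_irrefl _)⟩
    · subst hi
      rw [bstarCoeff_last, bstarCoeff_of_ne_last hj]
      exact ⟨_, (mul_one _).symm, fun _ => dvd_mul_right _ _⟩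
    · subst hj
      obtain ⟨x, hx⟩ := Ideal.mem_span_singleton.1 (hg _ _ (finRotate_pos hi))
      rw [bstarCoeff_last, bstarCoeff_of_ne_last hi, finRotate_last, hx]
      exact ⟨x, by ring, fun h => absurd h (Fin.le_last i).not_gt⟩
    · rw [bstarCoeff_of_ne_last hi, bstarCoeff_of_ne_last hj]
      exact ⟨_, mul_comm _ _, fun h =>
        Ideal.mem_span_singleton.1 (hg _ _ ((finRotate_lt_finRotate hi hj).2 h))⟩
  choose h h_eq h_dvd using entry
  exact ⟨h, fun i j hij => Ideal.mem_span_singleton.2 (h_dvd i j hij),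
    (bstar_mul_eq_mul_bstar_iff n g h).2 h_eq⟩

lemma exists_mem_Bset_mul_bstar_eq {n : ℕ} {h : Matrix (Fin (n + 1)) (Fin (n + 1)) R}
    (hh : h ∈ Bset (n + 1)) :
    ∃ g ∈ Bset (n + 1), bstar (n + 1) * ι (n + 1) g = ι (n + 1) h * bstar (n + 1) := by
  have entry (i j : Fin (n + 1)) : ∃ y : R, bstarCoeff n i * y = h i j * bstarCoeff n j ∧
      (finRotate (n + 1) j < finRotate (n + 1) i → u ∣ y) := by
    by_cases hi : i = Fin.last n <;> by_cases hj : j = Fin.last n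
    · subst hi hj
      exact ⟨_, mul_comm _ _, fun h => absurd h (lt_irrefl _)⟩
    · subst hi
      obtain ⟨y, hy⟩ := Ideal.mem_span_singleton.1 (hh _ _ (Fin.lt_last_iff_ne_last.2 hj))
      rw [bstarCoeff_last, bstarCoeff_of_ne_last hj, hy, finRotate_last]
      exact ⟨y, (mul_one _).symm, fun h => absurd h (Fin.zero_le _).not_gt⟩
    · subst hj
      rw [bstarCoeff_last, bstarCoeff_of_ne_last hi]
      exact ⟨_, one_mul _, fun _ => dvd_mul_left _ _⟩
    · rw [bstarCoeff_of_ne_last hi, bstarCoeff_of_ne_last hj]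
      exact ⟨h i j, mul_comm _ _, fun hij =>
        Ideal.mem_span_singleton.1 (hh _ _ ((finRotate_lt_finRotate hi hj).1 hij))⟩
  choose y y_eq y_dvd using entry
  refine ⟨fun a b => y ((finRotate (n + 1)).symm a) ((finRotate (n + 1)).symm b),
    fun a b hab => Ideal.mem_span_singleton.2 (y_dvd _ _ (by simpa using hab)),
    (bstar_mul_eq_mul_bstar_iff n _ h).2 fun i j => ?_⟩
  simpa only [Equiv.symm_apply_apply] using y_eq i j

lemma diag_eq_of_bstar_mul_eq {n : ℕ} {g h : Matrix (Fin (n + 1)) (Fin (n + 1)) R}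
    (hgh : bstar (n + 1) * ι (n + 1) g = ι (n + 1) h * bstar (n + 1)) (i : Fin (n + 1)) :
    g (finRotate (n + 1) i) (finRotate (n + 1) i) = h i i := by
  have := (bstar_mul_eq_mul_bstar_iff n g h).1 hgh i i
  rw [mul_comm] at this
  exact mul_right_cancel₀ (bstarCoeff_ne_zero n i) this

lemma bstar_mul_mset_finRotate (n : ℕ) (i : Fin (n + 1)) :
    (fun g => bstar (n + 1) * ι (n + 1) g) '' mset (n + 1) (finRotate (n + 1) i) =
      (fun g => ι (n + 1) g * bstar (n + 1)) '' mset (n + 1) i := by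
  ext x
  constructor
  · rintro ⟨g, ⟨hg, hgi⟩, rfl⟩
    obtain ⟨h, hh, hgh⟩ := exists_mem_Bset_bstar_mul_eq hg
    exact ⟨h, ⟨hh, diag_eq_of_bstar_mul_eq hgh i ▸ hgi⟩, hgh.symm⟩
  · rintro ⟨h, ⟨hh, hhi⟩, rfl⟩
    obtain ⟨g, hg, hgh⟩ := exists_mem_Bset_mul_bstar_eq hh
    exact ⟨g, ⟨hg, (diag_eq_of_bstar_mul_eq hgh i).symm ▸ hhi⟩, hgh⟩

theorem bstar_mul_mset (e : ℕ) (he : 1 ≤ e) :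
    ((fun g => bstar e * ι e g) '' mset e ⟨0, by omega⟩ =
      (fun g => ι e g * bstar e) '' mset e ⟨e - 1, by omega⟩) ∧
    (∀ i : Fin e, 1 ≤ (i : ℕ) →
      (fun g => bstar e * ι e g) '' mset e i =
        (fun g => ι e g * bstar e) '' mset e ⟨(i : ℕ) - 1, by omega⟩) := by
  obtain ⟨n, rfl⟩ := Nat.exists_eq_add_of_le' he
  refine ⟨?_, fun i hi => ?_⟩
  · have := bstar_mul_mset_finRotate n (Fin.last n)
    rwa [finRotate_last] at this
  · have hlt : (i : ℕ) - 1 < n := by omega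
    have hrot : finRotate (n + 1) ⟨(i : ℕ) - 1, by omega⟩ = i := by
      rw [finRotate_of_lt hlt]
      exact Fin.ext (Nat.sub_add_cancel hi)
    have := bstar_mul_mset_finRotate n ⟨(i : ℕ) - 1, by omega⟩
    rwa [hrot] at this
end
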